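/- For every n ∈ ℙ, ∑_{γ ∈ D_n} (-1)^{ℓ_D(γ)} q^{Dmaj(γ)} equals [2]_{-q}[4]_q[6]_{-q} ⋯ [2n-2]_{-q} [n]_q if n is even, and equals [2]_{-q}[4]_q ⋯ [2n-2]_q [n]_q if n is odd (the signed Mahonian polynomial of type D). -/

import Mathlib

open Finset Polynomial

/-- The hyperoctahedral group `B n`, modeled as pairs (permutation, sign vector):
the signed permutation with window `β(i) = ±(σ(i)+1)`. -/
abbrev Bgrp (n : ℕ) := Equiv.Perm (Fin n) × (Fin n → Bool)

/-- The window entry `β(i)` (a nonzero integer). -/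
def wdw {n : ℕ} (β : Bgrp n) (i : Fin n) : ℤ :=
  (if β.2 i then -1 else 1) * ((β.1 i : ℤ) + 1)

/-- Window entry at a `ℕ` position (0-based), `0` out of range. -/
def wdwN {n : ℕ} (β : Bgrp n) (i : ℕ) : ℤ :=
  if h : i < n then wdw β ⟨i, h⟩ else 0

/-- Number of inversions of the window. -/
def invB {n : ℕ} (β : Bgrp n) : ℕ :=
  ((univ : Finset (Fin n × Fin n)).filter
    (fun p => p.1 < p.2 ∧ wdw β p.2 < wdw β p.1)).card

/-- The set of positions with negative entries. -/
def NegB {n : ℕ} (β : Bgrp n) : Finset (Fin n) :=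
  univ.filter (fun i => wdw β i < 0)

def N1 {n : ℕ} (β : Bgrp n) : ℕ := (NegB β).card

def N2 {n : ℕ} (β : Bgrp n) : ℕ :=
  ((univ : Finset (Fin n × Fin n)).filter
    (fun p => p.1 < p.2 ∧ wdw β p.1 + wdw β p.2 < 0)).card

/-- The order `-1 ≺ -2 ≺ ⋯ ≺ -n ≺ 1 ≺ 2 ≺ ⋯ ≺ n` on nonzero integers. -/
def precLt (a b : ℤ) : Prop :=
  (a < 0 ∧ b < 0 ∧ b < a) ∨ (a < 0 ∧ 0 < b) ∨ (0 < a ∧ 0 < b ∧ a < b)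

instance (a b : ℤ) : Decidable (precLt a b) := by unfold precLt; infer_instance

/-- Descent set of the window, with respect to `≺` (0-based positions). -/
def DesB {n : ℕ} (β : Bgrp n) : Finset ℕ :=
  (range (n-1)).filter (fun i => precLt (wdwN β (i+1)) (wdwN β i))

/-- Major index: sum of the (1-based) descent positions. -/
def majB {n : ℕ} (β : Bgrp n) : ℕ := ∑ i ∈ DesB β, (i+1)

/-- Flag-major index. -/
def fmaj {n : ℕ} (β : Bgrp n) : ℕ := 2 * majB β + N1 β

/-- Group multiplication (composition of signed permutations). -/
def bmul {n : ℕ} (β γ : Bgrp n) : Bgrp n :=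
  (β.1 * γ.1, fun i => xor (γ.2 i) (β.2 (γ.1 i)))

/-- The identity signed permutation. -/
def bone (n : ℕ) : Bgrp n := (1, fun _ => false)

/-- The Coxeter generators `s_0, s_1, …, s_{n-1}` of `B n`. -/
def BGens (n : ℕ) : Set (Bgrp n) :=
  { b | (∃ h : 0 < n, b = ((1 : Equiv.Perm (Fin n)), fun j => decide (j = (⟨0, h⟩ : Fin n)))) ∨
        (∃ (i : ℕ) (h : i + 1 < n),
          b = (Equiv.swap ⟨i, Nat.lt_of_succ_lt h⟩ ⟨i+1, h⟩, fun _ => false)) }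

/-- Minimal length of an expression of `β` as a product of the generators of `B n`. -/
noncomputable def lenB {n : ℕ} (β : Bgrp n) : ℕ :=
  sInf {k | ∃ l : List (Bgrp n), l.length = k ∧ (∀ g ∈ l, g ∈ BGens n) ∧
    l.foldr bmul (bone n) = β}

/-- The Coxeter generators `s_0^D, s_1, …, s_{n-1}` of `D n`. -/
def DGens (n : ℕ) : Set (Bgrp n) :=
  { b | (∃ h : 1 < n,
          b = (Equiv.swap ⟨0, Nat.lt_of_succ_lt h⟩ ⟨1, h⟩, fun (j : Fin n) => decide ((j : ℕ) < 2))) ∨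
        (∃ (i : ℕ) (h : i + 1 < n),
          b = (Equiv.swap ⟨i, Nat.lt_of_succ_lt h⟩ ⟨i+1, h⟩, fun _ => false)) }

/-- Minimal length of an expression as a product of the generators of `D n`. -/
noncomputable def lenD {n : ℕ} (β : Bgrp n) : ℕ :=
  sInf {k | ∃ l : List (Bgrp n), l.length = k ∧ (∀ g ∈ l, g ∈ DGens n) ∧
    l.foldr bmul (bone n) = β}

/-- The even-signed permutation group `D n` as a finset of `B n`. -/
def Dgrp (n : ℕ) : Finset (Bgrp n) := univ.filter (fun γ => Even (N1 γ))

/-- `Δ_n = {γ ∈ B_n : γ(n) > 0}`. -/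
def DeltaSet (n : ℕ) : Finset (Bgrp n) := univ.filter (fun γ => 0 < wdwN γ (n-1))

/-- `|γ|_n`: replace the last window entry by its absolute value. -/
def absLast {n : ℕ} (γ : Bgrp n) : Bgrp n :=
  (γ.1, fun i => if (i : ℕ) = n - 1 then false else γ.2 i)

/-- The `D`-major index. -/
def Dmaj {n : ℕ} (γ : Bgrp n) : ℕ := fmaj (absLast γ)

/-- `-β`: negate all window entries. -/
def negB {n : ℕ} (β : Bgrp n) : Bgrp n := (β.1, fun i => !β.2 i)

/-- Number of inversions of a permutation of `Fin n`. -/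
def invS {n : ℕ} (σ : Equiv.Perm (Fin n)) : ℕ :=
  ((univ : Finset (Fin n × Fin n)).filter
    (fun p => p.1 < p.2 ∧ σ p.2 < σ p.1)).card

/-- Major index of a permutation of `Fin n` (usual order). -/
def majS {n : ℕ} (σ : Equiv.Perm (Fin n)) : ℕ :=
  ∑ i ∈ (range (n-1)).filter
      (fun i => ∀ h : i + 1 < n, σ ⟨i+1, h⟩ < σ ⟨i, Nat.lt_of_succ_lt h⟩), (i+1)

/-- The `q`-analogue `[m]_q = 1 + q + ⋯ + q^{m-1}`, evaluated at a polynomial `q`. -/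
noncomputable def qpoly (m : ℕ) (q : Polynomial ℤ) : Polynomial ℤ := ∑ k ∈ range m, q ^ k

/-! ### The sign of the Coxeter length -/

/-- The signed permutations which are products of the Coxeter generators of `D n`. -/
def DGenerated (n : ℕ) : Set (Bgrp n) :=
  {β | ∃ l : List (Bgrp n), (∀ g ∈ l, g ∈ DGens n) ∧ l.foldr bmul (bone n) = β}

lemma bmul_assoc {n : ℕ} (a b c : Bgrp n) : bmul (bmul a b) c = bmul a (bmul b c) := by
  ext i
  · simp [bmul]
  · simp [bmul]

lemma bone_bmul {n : ℕ} (a : Bgrp n) : bmul (bone n) a = a := by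
  ext i <;> simp [bmul, bone]

lemma bmul_bone {n : ℕ} (a : Bgrp n) : bmul a (bone n) = a := by
  ext i <;> simp [bmul, bone]

lemma bone_mem_DGenerated (n : ℕ) : bone n ∈ DGenerated n := ⟨[], by simp, rfl⟩

lemma DGens_subset_DGenerated {n : ℕ} {g : Bgrp n} (hg : g ∈ DGens n) : g ∈ DGenerated n :=
  ⟨[g], by simpa using hg, by simp [bmul_bone]⟩

lemma bmul_mem_DGenerated {n : ℕ} {a b : Bgrp n} (ha : a ∈ DGenerated n)
    (hb : b ∈ DGenerated n) : bmul a b ∈ DGenerated n := by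
  obtain ⟨l, hl, rfl⟩ := ha
  obtain ⟨l', hl', rfl⟩ := hb
  refine ⟨l ++ l', fun g hg => (List.mem_append.1 hg).elim (hl g) (hl' g), ?_⟩
  clear hl
  induction l with
  | nil => simp [bone_bmul]
  | cons a l ih => simp only [List.cons_append, List.foldr_cons, ih, bmul_assoc]

lemma unsigned_mem_DGenerated {n : ℕ} (σ : Equiv.Perm (Fin (n + 1))) :
    ((σ, fun _ => false) : Bgrp (n + 1)) ∈ DGenerated (n + 1) := by
  have hσ : σ ∈ Submonoid.closure
      (Set.range fun i : Fin n => Equiv.swap i.castSucc i.succ) := by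
    rw [Equiv.Perm.mclosure_swap_castSucc_succ]; trivial
  induction hσ using Submonoid.closure_induction with
  | mem x hx =>
    obtain ⟨i, rfl⟩ := hx
    exact DGens_subset_DGenerated (Or.inr ⟨i, by omega, rfl⟩)
  | one => exact bone_mem_DGenerated _
  | mul x y _ _ hx hy => simpa [bmul] using bmul_mem_DGenerated hx hy

lemma pair_mem_DGenerated {n : ℕ} (a : Fin (n + 1)) :
    ((1, fun i => xor (decide (i = a)) (decide (i = 0))) : Bgrp (n + 1)) ∈
      DGenerated (n + 1) := by
  by_cases ha : a = 0
  · subst ha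
    simpa [bone] using bone_mem_DGenerated (n + 1)
  · obtain ⟨m, rfl⟩ : ∃ m, n = m + 1 :=
      Nat.exists_eq_succ_of_ne_zero (by rintro rfl; exact ha (Fin.ext (by omega)))
    have hs : ((Equiv.swap 0 1, fun j => decide ((j : ℕ) < 2)) : Bgrp (m + 2)) ∈
        DGenerated (m + 2) := DGens_subset_DGenerated (Or.inl ⟨by omega, rfl⟩)
    have h := bmul_mem_DGenerated (unsigned_mem_DGenerated (Equiv.swap a 1 * Equiv.swap 0 1))
      (bmul_mem_DGenerated hs (unsigned_mem_DGenerated (Equiv.swap a 1)))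
    convert h using 1
    ext i
    · simp [bmul, mul_assoc]
    · have h01 : ∀ j : Fin (m + 2), (j : ℕ) < 2 ↔ j = 0 ∨ j = 1 := by
        intro j; simp only [Fin.ext_iff, Fin.val_zero, Fin.val_one]; omega
      simp only [bmul, h01, Bool.false_xor, Bool.xor_false]
      rcases eq_or_ne i a with rfl | hia
      · simp [ha]
      · rcases eq_or_ne i 1 with rfl | hi1
        · simp [ha, hia, hia.symm]
        · simp [Equiv.swap_apply_of_ne_of_ne hia hi1, hia, hi1]

lemma even_signs_mem_DGenerated {n : ℕ} (A : Finset (Fin (n + 1))) :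
    ((1, fun i => xor (decide (i ∈ A)) (decide (i = 0 ∧ Odd #A))) : Bgrp (n + 1)) ∈
      DGenerated (n + 1) := by
  induction A using Finset.induction_on with
  | empty => simpa [bone] using bone_mem_DGenerated (n + 1)
  | insert a A ha ih =>
    convert bmul_mem_DGenerated ih (pair_mem_DGenerated a) using 1
    ext i
    · simp [bmul]
    · have hpar : Odd (#A + 1) ↔ ¬ Odd #A := by simp [parity_simps]
      simp only [bmul, card_insert_of_notMem ha, hpar, mem_insert, Equiv.Perm.coe_one, id]
      by_cases h1 : i = a <;> by_cases h2 : i = 0 <;> by_cases h3 : Odd #A <;>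
        by_cases h4 : i ∈ A <;> simp_all

lemma NegB_eq {n : ℕ} (β : Bgrp n) : NegB β = univ.filter (fun i => β.2 i = true) := by
  ext i
  rw [NegB, mem_filter, mem_filter, wdw]
  simp only [mem_univ, true_and]
  split_ifs with h <;> simp only [h, iff_true, Bool.false_eq_true, iff_false] <;> omega

lemma Dgrp_subset_DGenerated {n : ℕ} {γ : Bgrp (n + 1)} (hγ : γ ∈ Dgrp (n + 1)) :
    γ ∈ DGenerated (n + 1) := by
  have hev : ¬ Odd #(NegB γ) := Nat.not_odd_iff_even.2 (mem_filter.1 hγ).2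
  convert bmul_mem_DGenerated (unsigned_mem_DGenerated γ.1)
    (even_signs_mem_DGenerated (NegB γ)) using 1
  ext i
  · simp [bmul]
  · simp only [bmul, hev, and_false]
    simp [NegB_eq]

lemma sign_foldr_bmul {n : ℕ} (l : List (Bgrp n)) (hl : ∀ g ∈ l, g ∈ DGens n) :
    Equiv.Perm.sign (l.foldr bmul (bone n)).1 = (-1) ^ l.length := by
  induction l with
  | nil => simp [bone]
  | cons g l ih =>
    have hg : Equiv.Perm.sign g.1 = -1 := by
      rcases hl g (by simp) with ⟨h, rfl⟩ | ⟨i, h, rfl⟩ <;>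
        exact Equiv.Perm.sign_swap (by simp [Fin.ext_iff])
    have := ih fun g hg => hl g (by simp [hg])
    simp only [List.foldr_cons, bmul, map_mul, this, hg, List.length_cons, pow_succ, mul_comm]

/-- The sign of the underlying permutation, as a polynomial. -/
noncomputable def signX {n : ℕ} (σ : Equiv.Perm (Fin n)) : ℤ[X] :=
  ((Equiv.Perm.sign σ : ℤ) : ℤ[X])

lemma signX_mul {n : ℕ} (σ τ : Equiv.Perm (Fin n)) : signX (σ * τ) = signX σ * signX τ := by
  simp [signX]

lemma neg_one_pow_lenD {n : ℕ} {γ : Bgrp (n + 1)} (hγ : γ ∈ Dgrp (n + 1)) :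
    (-1 : ℤ[X]) ^ lenD γ = signX γ.1 := by
  obtain ⟨l, hl, hlγ⟩ := Dgrp_subset_DGenerated hγ
  obtain ⟨l', hlen, hl', hlγ'⟩ := Nat.sInf_mem
    (s := {k | ∃ l : List (Bgrp (n + 1)), l.length = k ∧ (∀ g ∈ l, g ∈ DGens (n + 1)) ∧
      l.foldr bmul (bone (n + 1)) = γ}) ⟨_, l, rfl, hl, hlγ⟩
  have h := sign_foldr_bmul l' hl'
  rw [hlγ', hlen] at h
  change _ = (-1) ^ lenD γ at h
  simp [signX, h]

/-! ### Reduction to signed permutations with positive last entry -/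

/-- Flip the sign of the last window entry. -/
def flipLast {n : ℕ} (β : Bgrp (n + 1)) : Bgrp (n + 1) :=
  (β.1, fun i => xor (β.2 i) (decide (i = Fin.last n)))

lemma N1_eq_sum {n : ℕ} (β : Bgrp n) : N1 β = ∑ i, if β.2 i = true then 1 else 0 := by
  rw [N1, NegB_eq, card_filter]

lemma even_N1_flipLast {n : ℕ} (β : Bgrp (n + 1)) : Even (N1 (flipLast β)) ↔ ¬ Even (N1 β) := by
  simp only [N1_eq_sum, Fin.sum_univ_castSucc, flipLast, Fin.castSucc_ne_last, decide_false,
    Bool.xor_false, decide_true]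
  cases β.2 (Fin.last n) <;> simp [parity_simps]

lemma sum_Dgrp_absLast {n : ℕ} (F : Bgrp (n + 1) → ℤ[X]) :
    ∑ γ ∈ Dgrp (n + 1), F (absLast γ) =
      ∑ β : Bgrp (n + 1) with β.2 (Fin.last n) = false, F β := by
  have habs : ∀ β : Bgrp (n + 1), absLast β =
      if β.2 (Fin.last n) = false then β else flipLast β := by
    intro β
    have hl : ∀ i : Fin (n + 1), (i : ℕ) = n ↔ i = Fin.last n := fun i => by simp [Fin.ext_iff]
    split_ifs with h <;> ext i
    · rfl
    · by_cases hi : i = Fin.last n <;> simp [absLast, hl, hi, h]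
    · rfl
    · by_cases hi : i = Fin.last n <;> simp_all [absLast, flipLast]
  have hinv : ∀ β : Bgrp (n + 1), flipLast (flipLast β) = β := by
    intro β; ext i <;> simp [flipLast]
  have hlast : ∀ β : Bgrp (n + 1), (flipLast β).2 (Fin.last n) = !β.2 (Fin.last n) := by
    intro β; simp [flipLast]
  refine sum_nbij' absLast (fun β => if Even (N1 β) then β else flipLast β) ?_ ?_ ?_ ?_ ?_
  · intro β _
    rw [habs]
    split_ifs with h <;> simp_all
  · intro β _
    simp only [Dgrp, mem_filter, mem_univ, true_and]
    split_ifs with h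
    · exact h
    · exact (even_N1_flipLast β).2 h
  · intro β hβ
    simp only [Dgrp, mem_filter, mem_univ, true_and] at hβ
    rw [habs]
    by_cases h : β.2 (Fin.last n) = false
    · simp [h, hβ]
    · simp [h, even_N1_flipLast, hβ, hinv]
  · intro β hβ
    simp only [mem_filter, mem_univ, true_and] at hβ
    rw [habs]
    by_cases h : Even (N1 β)
    · simp [h, hβ]
    · simp [h, hlast, hβ, hinv]
  · intros; rfl

/-! ### The rotation of window values -/

/-- The rank of a window entry in the order `≺`. -/
def rk {n : ℕ} (β : Bgrp n) (i : Fin n) : ℕ := if β.2 i then β.1 i else n + β.1 i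

lemma rk_lt {n : ℕ} (β : Bgrp n) (i : Fin n) : rk β i < 2 * n := by
  have := (β.1 i).2
  unfold rk; split_ifs <;> omega

lemma precLt_wdw_iff {n : ℕ} (β : Bgrp n) (i j : Fin n) :
    precLt (wdw β i) (wdw β j) ↔ rk β i < rk β j := by
  have hi := (β.1 i).2
  have hj := (β.1 j).2
  unfold precLt wdw rk
  cases β.2 i <;> cases β.2 j <;> simp <;> omega

lemma majB_eq_sum {n : ℕ} (β : Bgrp (n + 1)) :
    majB β = ∑ i : Fin n, if rk β i.succ < rk β i.castSucc then (i : ℕ) + 1 else 0 := by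
  rw [majB, DesB, sum_filter, Nat.add_sub_cancel, ← Fin.sum_univ_eq_sum_range
    (fun i => if precLt (wdwN β (i + 1)) (wdwN β i) then i + 1 else 0)]
  refine sum_congr rfl fun i _ => ?_
  have h1 : wdwN β ((i : ℕ) + 1) = wdw β i.succ := by
    rw [wdwN, dif_pos (by omega)]; rfl
  have h2 : wdwN β (i : ℕ) = wdw β i.castSucc := by
    rw [wdwN, dif_pos (by omega)]; rfl
  simp only [h1, h2, precLt_wdw_iff]

/-- Cyclically shift all window values in the order `≺`. -/
def rot {n : ℕ} : Equiv.Perm (Bgrp (n + 1)) where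
  toFun β := (finRotate (n + 1) * β.1, fun i => xor (β.2 i) (decide (β.1 i = Fin.last n)))
  invFun β := ((finRotate (n + 1))⁻¹ * β.1, fun i => xor (β.2 i) (decide (β.1 i = 0)))
  left_inv β := by
    ext i
    · simp
    · have : finRotate (n + 1) (β.1 i) = 0 ↔ β.1 i = Fin.last n := by
        rw [← finRotate_last, (finRotate (n + 1)).injective.eq_iff]
      simp only [Equiv.Perm.mul_apply, this, Bool.xor_assoc, Bool.xor_self, Bool.xor_false]
  right_inv β := by
    ext i
    · simp
    · have : (finRotate (n + 1))⁻¹ (β.1 i) = Fin.last n ↔ β.1 i = 0 := by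
        rw [Equiv.Perm.inv_eq_iff_eq, finRotate_last]
      simp only [Equiv.Perm.mul_apply, this, Bool.xor_assoc, Bool.xor_self, Bool.xor_false]

lemma rk_rot {n : ℕ} (β : Bgrp (n + 1)) (i : Fin (n + 1)) :
    rk (rot β) i = if rk β i = 2 * n + 1 then 0 else rk β i + 1 := by
  have hlt := (β.1 i).2
  by_cases h : β.1 i = Fin.last n
  · cases hs : β.2 i <;> simp [rk, rot, h, hs] <;> omega
  · have h' := coe_finRotate_of_ne_last h
    have h2 : (β.1 i : ℕ) ≠ n := fun h3 => h (Fin.ext h3)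
    cases hs : β.2 i <;> simp only [rk, rot, Equiv.coe_fn_mk, Equiv.Perm.mul_apply, h, hs, h',
      decide_false, Bool.xor_false, if_true, Bool.false_eq_true, if_false] <;>
      split_ifs <;> omega

lemma signX_rot {n : ℕ} (β : Bgrp (n + 1)) : signX (rot β).1 = (-1) ^ n * signX β.1 := by
  rw [show (rot β).1 = finRotate (n + 1) * β.1 from rfl, signX_mul]
  simp [signX, sign_finRotate]

lemma N1_rot {n : ℕ} (β : Bgrp (n + 1)) (p : Fin (n + 1)) (hp : β.1 p = Fin.last n) :
    N1 (rot β) + (if β.2 p = true then 1 else 0) =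
      N1 β + (if β.2 p = true then 0 else 1) := by
  have hiff : ∀ i, β.1 i = Fin.last n ↔ i = p := fun i => by
    rw [← hp, β.1.injective.eq_iff]
  rw [N1_eq_sum, N1_eq_sum, ← add_sum_erase _ _ (mem_univ p),
    ← add_sum_erase univ (fun i => if β.2 i = true then 1 else 0) (mem_univ p)]
  have : ∀ i ∈ univ.erase p, (if (rot β).2 i = true then 1 else 0) =
      if β.2 i = true then 1 else 0 := by
    intro i hi
    simp [rot, hiff, ne_of_mem_erase hi]
  rw [sum_congr rfl this]
  cases h : β.2 p <;> simp [rot, h, hp] <;> omega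

lemma majB_rot_of_neg {n : ℕ} (β : Bgrp (n + 1)) (h : ∀ i, rk β i ≠ 2 * n + 1) :
    majB (rot β) = majB β := by
  simp [majB_eq_sum, rk_rot, h]

lemma majB_rot_of_pos {n : ℕ} (β : Bgrp (n + 1)) (p : Fin n)
    (hp : ∀ i, rk β i = 2 * n + 1 ↔ i = p.castSucc) : majB (rot β) + 1 = majB β := by
  have hpt : ∀ i : Fin n, (if rk (rot β) i.succ < rk (rot β) i.castSucc then (i : ℕ) + 1 else 0) +
      (if i = p then (i : ℕ) + 1 else 0) =
      (if rk β i.succ < rk β i.castSucc then (i : ℕ) + 1 else 0) +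
      (if i.succ = p.castSucc then (i : ℕ) + 1 else 0) := by
    intro i
    have h1 := rk_lt β i.succ
    have h2 := rk_lt β i.castSucc
    have hne : i.succ ≠ i.castSucc := by simp [Fin.ext_iff]
    have hc : i = p ↔ rk β i.castSucc = 2 * n + 1 := by
      rw [hp, (Fin.castSucc_injective n).eq_iff]
    have hs := (hp i.succ).symm
    have hsc : ¬ (i = p ∧ i.succ = p.castSucc) := by
      rintro ⟨rfl, h⟩
      exact hne h
    rw [hc, hs] at hsc
    simp only [rk_rot, hc, hs]
    split_ifs <;> omega
  have hsum := sum_congr (rfl : (univ : Finset (Fin n)) = univ) fun i _ => hpt i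
  rw [sum_add_distrib, sum_add_distrib, ← majB_eq_sum, ← majB_eq_sum, sum_ite_eq'] at hsum
  have hp' : (∑ i : Fin n, if i.succ = p.castSucc then (i : ℕ) + 1 else 0) = p := by
    rcases Nat.eq_zero_or_pos (p : ℕ) with h0 | h0
    · rw [h0]
      refine sum_eq_zero fun i _ => if_neg ?_
      simp [Fin.ext_iff, h0]
    · rw [sum_eq_single ⟨p - 1, by omega⟩]
      · rw [if_pos (by simp [Fin.ext_iff]; omega)]
        simp; omega
      · intro i _ hi
        refine if_neg fun h => hi ?_
        simp only [Fin.ext_iff, Fin.val_succ, Fin.val_castSucc] at h ⊢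
        omega
      · simp
  simp only [hp', mem_univ, if_true] at hsum
  omega

lemma fmaj_rot {n : ℕ} (β : Bgrp (n + 1)) (h : rk β (Fin.last n) ≠ 2 * n + 1) :
    fmaj (rot β) + 1 = fmaj β := by
  obtain ⟨p, hp⟩ := β.1.surjective (Fin.last n)
  have hrk : ∀ i, rk β i = 2 * n + 1 ↔ i = p ∧ β.2 p = false := by
    intro i
    have hiff : i = p ↔ (β.1 i : ℕ) = n := by
      rw [← β.1.injective.eq_iff, hp, Fin.ext_iff, Fin.val_last]
    have hlt := (β.1 i).2
    by_cases hi : i = p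
    · subst hi
      cases hs : β.2 i <;> simp [rk, hs, hp] <;> omega
    · have := mt hiff.2 hi
      cases hs : β.2 i <;> simp [rk, hs, hi] <;> omega
  have hN := N1_rot β p hp
  unfold fmaj
  cases hs : β.2 p
  · obtain ⟨p, rfl⟩ := Fin.exists_castSucc_eq.2
      (fun hpl : p = Fin.last n => h ((hrk _).2 ⟨hpl.symm, hs⟩))
    have := majB_rot_of_pos β p (by simpa [hs] using hrk)
    simp only [hs, Bool.false_eq_true, if_false] at hN
    omega
  · rw [majB_rot_of_neg β (by simp [hrk, hs])]
    simp only [hs, if_true] at hN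
    omega

/-! ### Generating functions -/

/-- The signed weight of a signed permutation. -/
noncomputable def weight {n : ℕ} (β : Bgrp n) : ℤ[X] := signX β.1 * X ^ fmaj β

/-- The signed generating function of signed permutations whose last entry has rank `r`. -/
noncomputable def lastSum (n r : ℕ) : ℤ[X] :=
  ∑ β : Bgrp (n + 1) with rk β (Fin.last n) = r, weight β

lemma lastSum_succ {n r : ℕ} (hr : r < 2 * n + 1) :
    lastSum n r = (-1) ^ n * X * lastSum n (r + 1) := by
  rw [lastSum, lastSum, mul_sum]
  refine sum_equiv rot (fun β => ?_) fun β hβ => ?_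
  · rw [mem_filter, mem_filter, rk_rot]
    simp only [mem_univ, true_and]
    split_ifs with h
    · exact iff_of_false (by omega) not_false
    · omega
  · simp only [mem_filter, mem_univ, true_and] at hβ
    have hf := fmaj_rot β (by omega)
    rw [weight, weight, signX_rot, ← hf]
    have : ((-1 : ℤ[X]) ^ n) * (-1) ^ n = 1 := by rw [← mul_pow]; simp
    linear_combination (-signX β.1 * X ^ (fmaj (rot β) + 1)) * this

lemma lastSum_eq {n k : ℕ} (hk : k ≤ 2 * n + 1) :
    lastSum n (2 * n + 1 - k) = ((-1) ^ n * X) ^ k * lastSum n (2 * n + 1) := by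
  induction k with
  | zero => simp
  | succ k ih =>
    rw [lastSum_succ (by omega), show 2 * n + 1 - (k + 1) + 1 = 2 * n + 1 - k by omega,
      ih (by omega), pow_succ]
    ring

/-- Append a fixed positive maximal last entry. -/
def extendB {n : ℕ} (β : Bgrp n) : Bgrp (n + 1) :=
  (finSuccEquivLast.symm.permCongr (Equiv.optionCongr β.1),
    Fin.snoc (α := fun _ => Bool) β.2 false)

lemma extendB_fst_castSucc {n : ℕ} (β : Bgrp n) (i : Fin n) :
    (extendB β).1 i.castSucc = (β.1 i).castSucc := by
  simp [extendB, Equiv.permCongr_apply]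

lemma extendB_fst_last {n : ℕ} (β : Bgrp n) : (extendB β).1 (Fin.last n) = Fin.last n := by
  simp [extendB, Equiv.permCongr_apply]

lemma extendB_snd_castSucc {n : ℕ} (β : Bgrp n) (i : Fin n) :
    (extendB β).2 i.castSucc = β.2 i := by
  simp [extendB]

lemma extendB_snd_last {n : ℕ} (β : Bgrp n) : (extendB β).2 (Fin.last n) = false := by
  simp [extendB]

lemma signX_extendB {n : ℕ} (β : Bgrp n) : signX (extendB β).1 = signX β.1 := by
  simp [signX, extendB, Equiv.optionCongr_sign]

lemma fmaj_extendB {n : ℕ} (β : Bgrp n) : fmaj (extendB β) = fmaj β := by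
  have hN : N1 (extendB β) = N1 β := by
    rw [N1_eq_sum, N1_eq_sum, Fin.sum_univ_castSucc]
    simp only [extendB_snd_castSucc, extendB_snd_last, Bool.false_eq_true, if_false, add_zero]
  have hlast : rk (extendB β) (Fin.last n) = 2 * n + 1 := by
    simp [rk, extendB_fst_last, extendB_snd_last]; omega
  have hmaj : majB (extendB β) = majB β := by
    cases n with
    | zero => simp [majB, DesB]
    | succ n =>
      have hrk : ∀ i j : Fin (n + 1), rk (extendB β) i.castSucc < rk (extendB β) j.castSucc ↔
          rk β i < rk β j := by
        intro i j
        have h1 := (β.1 i).2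
        have h2 := (β.1 j).2
        simp only [rk, extendB_fst_castSucc, extendB_snd_castSucc, Fin.val_castSucc]
        cases β.2 i <;> cases β.2 j <;> simp <;> omega
      have h := rk_lt (extendB β) (Fin.last n).castSucc
      rw [majB_eq_sum, majB_eq_sum, Fin.sum_univ_castSucc, Fin.succ_last, hlast,
        if_neg (by omega), add_zero]
      refine sum_congr rfl fun i _ => ?_
      simp only [Fin.succ_castSucc, hrk, Fin.val_castSucc]
  rw [fmaj, fmaj, hN, hmaj]

lemma rk_last_eq_top_iff {n : ℕ} (β : Bgrp (n + 1)) :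
    rk β (Fin.last n) = 2 * n + 1 ↔ β.1 (Fin.last n) = Fin.last n ∧ β.2 (Fin.last n) = false := by
  have := (β.1 (Fin.last n)).2
  rw [Fin.ext_iff, Fin.val_last]
  cases h : β.2 (Fin.last n) <;> simp [rk, h] <;> omega

lemma lastSum_top (n : ℕ) : lastSum n (2 * n + 1) = ∑ β : Bgrp n, weight β := by
  symm
  refine sum_nbij extendB ?_ ?_ ?_ ?_
  · intro β _
    simp [rk_last_eq_top_iff, extendB_fst_last, extendB_snd_last]
  · intro β _ β' _ h
    ext i
    · have := extendB_fst_castSucc β i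
      rw [h, extendB_fst_castSucc] at this
      simpa [Fin.ext_iff] using this.symm
    · rw [← extendB_snd_castSucc β, h, extendB_snd_castSucc]
  · intro β hβ
    simp only [coe_filter, mem_univ, true_and, Set.mem_ofPred_eq, rk_last_eq_top_iff] at hβ
    obtain ⟨h1, h2⟩ := hβ
    refine ⟨(Equiv.removeNone (finSuccEquivLast.permCongr β.1), fun i => β.2 i.castSucc),
      by simp, ?_⟩
    refine Prod.ext ?_ ?_
    · have hn : finSuccEquivLast.permCongr β.1 none = none := by
        simp [Equiv.permCongr_apply, h1]
      simp only [extendB]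
      rw [map_equiv_removeNone, hn, Equiv.swap_self]
      ext i; simp [Equiv.permCongr_apply]
    · funext i
      refine Fin.lastCases ?_ (fun i => ?_) i
      · simp [extendB, h2]
      · simp [extendB]
  · intro β _
    rw [weight, weight, signX_extendB, fmaj_extendB]

lemma sum_lastSum_range (n m : ℕ) (hm : m ≤ 2 * n + 2) :
    ∑ k ∈ range m, lastSum n (2 * n + 1 - k) =
      qpoly m ((-1) ^ n * X) * ∑ β : Bgrp n, weight β := by
  rw [qpoly, sum_mul]
  refine sum_congr rfl fun k hk => ?_
  rw [lastSum_eq (by have := mem_range.1 hk; omega), lastSum_top]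

lemma sum_weight_succ (n : ℕ) :
    ∑ β : Bgrp (n + 1), weight β =
      qpoly (2 * (n + 1)) ((-1) ^ n * X) * ∑ β : Bgrp n, weight β := by
  rw [← sum_lastSum_range n _ (by omega)]
  refine (sum_fiberwise_of_maps_to (g := fun β : Bgrp (n + 1) => 2 * n + 1 - rk β (Fin.last n))
    (fun β _ => mem_range.2 (by omega)) _).symm.trans (sum_congr rfl fun k hk => ?_)
  refine sum_congr (filter_congr fun β _ => ?_) fun _ _ => rfl
  have := rk_lt β (Fin.last n)
  have := mem_range.1 hk
  omega

lemma sum_weight_last_pos (n : ℕ) :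
    ∑ β : Bgrp (n + 1) with β.2 (Fin.last n) = false, weight β =
      qpoly (n + 1) ((-1) ^ n * X) * ∑ β : Bgrp n, weight β := by
  rw [← sum_lastSum_range n _ (by omega)]
  have hrk : ∀ β : Bgrp (n + 1), β.2 (Fin.last n) = false ↔ n < rk β (Fin.last n) := by
    intro β
    have := (β.1 (Fin.last n)).2
    cases h : β.2 (Fin.last n) <;> simp [rk, h] <;> omega
  refine (sum_fiberwise_of_maps_to (g := fun β : Bgrp (n + 1) => 2 * n + 1 - rk β (Fin.last n))
    (fun β hβ => mem_range.2 ?_) _).symm.trans (sum_congr rfl fun k hk => ?_)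
  · have := (hrk β).1 (mem_filter.1 hβ).2
    omega
  · rw [filter_filter]
    refine sum_congr (filter_congr fun β _ => ?_) fun _ _ => rfl
    rw [hrk]
    have := rk_lt β (Fin.last n)
    have := mem_range.1 hk
    omega

lemma sum_weight (n : ℕ) :
    ∑ β : Bgrp n, weight β = ∏ i ∈ range n, qpoly (2 * (i + 1)) ((-1) ^ i * X) := by
  induction n with
  | zero =>
    rw [Fintype.sum_subsingleton _ (bone 0)]
    simp [bone, weight, signX, fmaj, majB, DesB, N1, NegB]
  | succ n ih => rw [sum_weight_succ, ih, prod_range_succ, mul_comm]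

lemma qpoly_two_mul (m : ℕ) (q : ℤ[X]) : qpoly (2 * m) q = (1 + q) * qpoly m (q ^ 2) := by
  induction m with
  | zero => simp [qpoly]
  | succ m ih =>
    simp only [qpoly] at ih ⊢
    rw [mul_add, sum_range_succ, sum_range_succ, ih, sum_range_succ]
    ring

lemma prod_one_add_mul_qpoly (n : ℕ) :
    (∏ i ∈ range n, (1 + (-1) ^ i * X)) * qpoly (n + 1) ((-1) ^ n * X) =
      (∏ i ∈ range n, (1 + (-1) ^ (i + 1) * X)) * qpoly (n + 1) (X : ℤ[X]) := by
  have hpair : ∀ k : ℕ, (∏ i ∈ range (2 * k), (1 + (-1) ^ i * X) : ℤ[X]) =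
      ∏ i ∈ range (2 * k), (1 + (-1) ^ (i + 1) * X) := by
    intro k
    induction k with
    | zero => simp
    | succ k ih =>
      rw [mul_add, prod_range_succ, prod_range_succ, ih, prod_range_succ, prod_range_succ]
      simp only [pow_succ, pow_mul]
      ring
  obtain ⟨k, rfl | rfl⟩ := Nat.even_or_odd' n
  · simp [hpair, pow_mul]
  · rw [prod_range_succ, prod_range_succ, hpair, show 2 * k + 1 + 1 = 2 * (k + 1) by ring,
      qpoly_two_mul, qpoly_two_mul]
    simp only [pow_succ, pow_mul]
    ring_nf

/-- Signed Mahonian of type `D`: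
`∑_{γ ∈ D_n} (-1)^{ℓ_D γ} q^{Dmaj γ} = [2]_{-q}[4]_q ⋯ [2n-2]_{±q} [n]_q`, the factor
`[2i]` being evaluated at `(-1)^i q` (so the last factor `[2n-2]` is at `-q` for `n`
even and at `q` for `n` odd, as in the two cases of the theorem). -/
theorem stmt19 (n : ℕ) (hn : 0 < n) :
    ∑ γ ∈ Dgrp n, (-1 : Polynomial ℤ) ^ lenD γ * X ^ Dmaj γ =
      (∏ i ∈ range (n-1), qpoly (2*(i+1)) ((-1 : Polynomial ℤ) ^ (i+1) * X)) * qpoly n X := by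
  obtain ⟨n, rfl⟩ : ∃ m, n = m + 1 := Nat.exists_eq_succ_of_ne_zero hn.ne'
  have hsum : ∑ γ ∈ Dgrp (n + 1), (-1 : ℤ[X]) ^ lenD γ * X ^ Dmaj γ =
      ∑ γ ∈ Dgrp (n + 1), weight (absLast γ) :=
    sum_congr rfl fun γ hγ => by rw [neg_one_pow_lenD hγ]; rfl
  have hsq : ∀ i : ℕ, ((-1 : ℤ[X]) ^ i * X) ^ 2 = X ^ 2 := fun i => by
    rw [mul_pow, ← pow_mul, mul_comm i, pow_mul]; simp
  rw [hsum, sum_Dgrp_absLast, sum_weight_last_pos, sum_weight, Nat.add_sub_cancel]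
  simp only [qpoly_two_mul, hsq, prod_mul_distrib]
  linear_combination (∏ i ∈ range n, qpoly (i + 1) (X ^ 2)) * prod_one_add_mul_qpoly n
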